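/- Let Ω ⊂ ℝ^n be an open bounded convex set and let u be the torsion function of Ω. Then the function √u is concave on Ω. -/

import Mathlib

open MeasureTheory Metric Set Filter Bornology
open scoped Topology Pointwise RealInnerProductSpace ENNReal NNReal BigOperators Classical

noncomputable section

/-- Euclidean `n`-space. -/
abbrev Euc (n : ℕ) : Type := EuclideanSpace ℝ (Fin n)

variable {n : ℕ}

/-- The Laplacian of `u`, as the sum of the pure second derivatives in the coordinate
directions. -/
def lapl (u : Euc n → ℝ) (x : Euc n) : ℝ :=
  ∑ i : Fin n, iteratedFDeriv ℝ 2 u x (fun _ => EuclideanSpace.single i (1 : ℝ))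

/-- `u` is the torsion function of `Ω`: the solution of `Δu = -2` in `Ω`, `u = 0` on `∂Ω`,
continuous up to the boundary and smooth inside. -/
structure IsTorsionFunction (Ω : Set (Euc n)) (u : Euc n → ℝ) : Prop where
  continuousOn : ContinuousOn u (closure Ω)
  smooth : ContDiffOn ℝ (⊤ : ℕ∞) u Ω
  lapl_eq : ∀ x ∈ Ω, lapl u x = -2
  boundary_zero : ∀ x ∈ frontier Ω, u x = 0

/-- The torsional rigidity `τ(Ω) = ∫_Ω ‖∇u‖²` where `u` is the torsion function of `Ω`. -/
def torsionRigidity (Ω : Set (Euc n)) : ℝ :=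
  if h : ∃ u, IsTorsionFunction Ω u then ∫ x in Ω, ‖gradient h.choose x‖ ^ 2 else 0

/-- The nontangential cone `Γ_α(x̄) = {x ∈ Ω : |x - x̄| ≤ (1+α) dist(x, ∂Ω)}`. -/
def ntCone (Ω : Set (Euc n)) (x : Euc n) (α : ℝ) : Set (Euc n) :=
  {y ∈ Ω | dist y x ≤ (1 + α) * infDist y (frontier Ω)}

/-- `w` has nontangential limit `L` at the boundary point `x`. -/
def HasNTLimitAt {F : Type*} [TopologicalSpace F] (Ω : Set (Euc n)) (w : Euc n → F)
    (x : Euc n) (L : F) : Prop :=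
  ∀ α > 0, Tendsto w (𝓝[ntCone Ω x α] x) (𝓝 L)

/-- The nontangential boundary values of `∇u` (junk value `0` where they do not exist). -/
def ntGradient (Ω : Set (Euc n)) (u : Euc n → ℝ) (x : Euc n) : Euc n :=
  if h : ∃ L, HasNTLimitAt Ω (gradient u) x L then h.choose else 0

/-- `X` is an outer unit normal to `K` at `x`. -/
def IsOuterNormalAt (K : Set (Euc n)) (x X : Euc n) : Prop :=
  ‖X‖ = 1 ∧ ∀ y ∈ K, ⟪y, X⟫ ≤ ⟪x, X⟫

/-- The Gauss map of `K`: the outer unit normal at the points of `∂K` where it is unique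
(i.e. where `∂K` is differentiable), junk value `0` elsewhere. -/
def gaussMap (K : Set (Euc n)) (x : Euc n) : Euc n :=
  if h : ∃! X, IsOuterNormalAt K x X then h.choose else 0

/-- The support function of a set: `h_K(X) = sup_{y ∈ K} ⟨y, X⟩`. -/
def suppFn (K : Set (Euc n)) (X : Euc n) : ℝ :=
  sSup ((fun y => ⟪y, X⟫) '' K)

/-- The measure `μ_{τ,Ω}(η) = ∫_{ν⁻¹(η)} |∇u|² dH^{n-1}` (as a set function on Borel sets
`η ⊆ S^{n-1}`), where `ν` is the Gauss map and `∇u` is taken in the sense of nontangential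
limits. -/
def torsionMeasure (Ω : Set (Euc n)) (u : Euc n → ℝ) (η : Set (Euc n)) : ℝ≥0∞ :=
  ∫⁻ x in frontier Ω ∩ gaussMap (closure Ω) ⁻¹' η,
    ENNReal.ofReal (‖ntGradient Ω u x‖ ^ 2) ∂μH[(n : ℝ) - 1]

/-- The mixed torsional rigidity `τ₁(Ω, Ω') = ∫_{∂Ω} h_{Ω'}(ν(x)) ‖∇u(x)‖² dH^{n-1}(x)`. -/
def mixedTorsion (Ω Ω' : Set (Euc n)) : ℝ :=
  if h : ∃ u, IsTorsionFunction Ω u then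
    ∫ x in frontier Ω,
      suppFn (closure Ω') (gaussMap (closure Ω) x) * ‖ntGradient Ω h.choose x‖ ^ 2
        ∂μH[(n : ℝ) - 1]
  else 0

/-- The Alexandrov body `B[g] = {x : ⟨x, X⟩ ≤ g(X) for all X ∈ S^{n-1}}` of a positive
continuous function `g` on the sphere. -/
def alexandrovBody (g : Euc n → ℝ) : Set (Euc n) :=
  {x | ∀ X ∈ sphere (0 : Euc n) 1, ⟪x, X⟫ ≤ g X}

/-- `g` is differentiable near `0`, with `g' 0 = a` and `g'' 0 = b`. -/
def HasTwoDerivsAtZero (g : ℝ → ℝ) (a b : ℝ) : Prop :=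
  ∃ g' : ℝ → ℝ, (∀ᶠ s in 𝓝 0, HasDerivAt g (g' s) s) ∧ g' 0 = a ∧ HasDerivAt g' b 0

namespace HasTwoDerivsAtZero

variable {f g : ℝ → ℝ} {a b a' b' : ℝ}

theorem const (c : ℝ) : HasTwoDerivsAtZero (fun _ => c) 0 0 :=
  ⟨fun _ => 0, Eventually.of_forall fun s => hasDerivAt_const s c, rfl, hasDerivAt_const 0 0⟩

theorem add (hf : HasTwoDerivsAtZero f a b) (hg : HasTwoDerivsAtZero g a' b') :
    HasTwoDerivsAtZero (fun s => f s + g s) (a + a') (b + b') := by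
  obtain ⟨f', hf1, rfl, hf2⟩ := hf
  obtain ⟨g', hg1, rfl, hg2⟩ := hg
  refine ⟨fun s => f' s + g' s, ?_, rfl, hf2.add hg2⟩
  filter_upwards [hf1, hg1] with s h1 h2 using h1.add h2

theorem const_mul (c : ℝ) (hf : HasTwoDerivsAtZero f a b) :
    HasTwoDerivsAtZero (fun s => c * f s) (c * a) (c * b) := by
  obtain ⟨f', hf1, rfl, hf2⟩ := hf
  refine ⟨fun s => c * f' s, ?_, rfl, hf2.const_mul c⟩
  filter_upwards [hf1] with s h1 using h1.const_mul c

theorem sub (hf : HasTwoDerivsAtZero f a b) (hg : HasTwoDerivsAtZero g a' b') :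
    HasTwoDerivsAtZero (fun s => f s - g s) (a - a') (b - b') := by
  simpa [sub_eq_add_neg] using hf.add (hg.const_mul (-1))

theorem sqrt (hf : HasTwoDerivsAtZero f a b) (h0 : 0 < f 0) :
    HasTwoDerivsAtZero (fun s => √(f s)) (a / (2 * √(f 0)))
      (b / (2 * √(f 0)) - (a / (2 * √(f 0))) ^ 2 / √(f 0)) := by
  obtain ⟨f', hf1, rfl, hf2⟩ := hf
  have hcont : ContinuousAt f 0 := hf1.self_of_nhds.continuousAt
  have hpos : ∀ᶠ s in 𝓝 0, 0 < f s := hcont.eventually (lt_mem_nhds h0)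
  refine ⟨fun s => f' s / (2 * √(f s)), ?_, rfl, ?_⟩
  · filter_upwards [hf1, hpos] with s h1 h2 using h1.sqrt h2.ne'
  · have hs : 0 < √(f 0) := Real.sqrt_pos.2 h0
    have h := hf2.div ((hf1.self_of_nhds.sqrt h0.ne').const_mul 2) (by positivity)
    refine h.congr_deriv ?_
    field_simp

theorem eq_zero_and_nonpos_of_isLocalMax (hg : HasTwoDerivsAtZero g a b)
    (hmax : IsLocalMax g 0) : a = 0 ∧ b ≤ 0 := by
  obtain ⟨g', hg1, rfl, hg2⟩ := hg
  have ha : g' 0 = 0 := hmax.hasDerivAt_eq_zero hg1.self_of_nhds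
  refine ⟨ha, ?_⟩
  by_contra! hb
  have hd : deriv g =ᶠ[𝓝 0] g' := hg1.mono fun s hs => hs.deriv
  have hdd : deriv (deriv g) 0 = b := by rw [hd.deriv_eq, hg2.deriv]
  have hmin : IsLocalMin g 0 := isLocalMin_of_deriv_deriv_pos (by rwa [hdd])
    (by rw [hg1.self_of_nhds.deriv, ha]) hg1.self_of_nhds.continuousAt
  have hconst : g =ᶠ[𝓝 0] fun _ => g 0 := by
    filter_upwards [hmin, hmax] with s h1 h2 using le_antisymm h2 h1
  have : deriv (deriv g) 0 = 0 := by
    rw [hconst.deriv.deriv_eq]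
    simp
  linarith

end HasTwoDerivsAtZero

theorem ContDiffAt.hasTwoDerivsAtZero_line {E : Type*} [NormedAddCommGroup E]
    [NormedSpace ℝ E] {u : E → ℝ} {q : E} (hu : ContDiffAt ℝ 2 u q) (e : E) (c : ℝ) :
    HasTwoDerivsAtZero (fun s => u (q + s • c • e)) (c * fderiv ℝ u q e)
      (c ^ 2 * iteratedFDeriv ℝ 2 u q (fun _ => e)) := by
  have hline : ∀ s : ℝ, HasDerivAt (fun s : ℝ => q + s • c • e) (c • e) s := fun s => by
    simpa using ((hasDerivAt_id s).smul_const (c • e)).const_add q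
  have hq : q + (0 : ℝ) • c • e = q := by simp
  refine ⟨fun s => fderiv ℝ u (q + s • c • e) (c • e), ?_, by simp, ?_⟩
  · have hev : ∀ᶠ y in 𝓝 q, DifferentiableAt ℝ u y :=
      (hu.eventually (by simp)).mono fun y hy => hy.differentiableAt (by simp)
    have htend : Tendsto (fun s : ℝ => q + s • c • e) (𝓝 0) (𝓝 q) := by
      have := (hline 0).continuousAt.tendsto
      rwa [hq] at this
    filter_upwards [htend.eventually hev] with s hs
    exact hs.hasFDerivAt.comp_hasDerivAt s (hline s)
  · have hd : DifferentiableAt ℝ (fderiv ℝ u) (q + (0 : ℝ) • c • e) := by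
      rw [hq]
      exact (hu.fderiv_right (m := 1) (by norm_num)).differentiableAt (by simp)
    have hcomp : HasDerivAt (fun s : ℝ => fderiv ℝ u (q + s • c • e))
        (fderiv ℝ (fderiv ℝ u) (q + (0 : ℝ) • c • e) (c • e)) 0 :=
      HasFDerivAt.comp_hasDerivAt (l := fderiv ℝ u) (f := fun s : ℝ => q + s • c • e)
        (0 : ℝ) hd.hasFDerivAt (hline 0)
    refine (hcomp.clm_apply (hasDerivAt_const (0 : ℝ) (c • e))).congr_deriv ?_
    rw [iteratedFDeriv_two_apply, hq]
    simp
    ring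

theorem IsOpen.eventually_line_mem {E : Type*} [NormedAddCommGroup E] [NormedSpace ℝ E]
    {Ω : Set E} (hΩ : IsOpen Ω) {q : E} (hq : q ∈ Ω) (e : E) :
    ∀ᶠ s : ℝ in 𝓝 0, q + s • e ∈ Ω := by
  have hc : Continuous fun s : ℝ => q + s • e := by fun_prop
  exact hc.continuousAt.eventually (hΩ.mem_nhds (by simpa using hq))

namespace IsTorsionFunction

variable {Ω : Set (Euc n)} {u : Euc n → ℝ}

theorem contDiffAt (hu : IsTorsionFunction Ω u) (hΩo : IsOpen Ω) {q : Euc n} (hq : q ∈ Ω) :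
    ContDiffAt ℝ 2 u q :=
  (hu.smooth.contDiffAt (hΩo.mem_nhds hq)).of_le (WithTop.coe_le_coe.2 (le_top : (2 : ℕ∞) ≤ ⊤))

theorem eq_zero_of_notMem (hu : IsTorsionFunction Ω u) (hΩo : IsOpen Ω) {q : Euc n}
    (hq : q ∈ closure Ω) (hq' : q ∉ Ω) : u q = 0 :=
  hu.boundary_zero q ⟨hq, by rwa [hΩo.interior_eq]⟩

theorem not_isMinOn (hu : IsTorsionFunction Ω u) (hΩo : IsOpen Ω) {q : Euc n} (hq : q ∈ Ω) :
    ¬ IsMinOn u (closure Ω) q := by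
  intro hmin
  have key : 0 ≤ lapl u q := by
    refine Finset.sum_nonneg fun i _ => ?_
    have h := ((hu.contDiffAt hΩo hq).hasTwoDerivsAtZero_line
      (EuclideanSpace.single i (1 : ℝ)) 1).const_mul (-1)
    have hmax : IsLocalMax
        (fun s : ℝ => -1 * u (q + s • (1 : ℝ) • EuclideanSpace.single i (1 : ℝ))) 0 := by
      filter_upwards [hΩo.eventually_line_mem hq ((1 : ℝ) • EuclideanSpace.single i (1 : ℝ))]
        with s hs
      have := isMinOn_iff.1 hmin _ (subset_closure hs)
      simpa using this
    have := (h.eq_zero_and_nonpos_of_isLocalMax hmax).2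
    linarith
  rw [hu.lapl_eq q hq] at key
  linarith

theorem pos (hu : IsTorsionFunction Ω u) (hΩo : IsOpen Ω) (hΩb : IsBounded Ω) {q : Euc n}
    (hq : q ∈ Ω) : 0 < u q := by
  obtain ⟨p, hp, hmin⟩ := hΩb.isCompact_closure.exists_isMinOn ⟨q, subset_closure hq⟩
    hu.continuousOn
  have hp0 : u p = 0 := hu.eq_zero_of_notMem hΩo hp fun h => hu.not_isMinOn hΩo h hmin
  rw [isMinOn_iff, hp0] at hmin
  refine (hmin q (subset_closure hq)).lt_of_ne' fun h => hu.not_isMinOn hΩo hq ?_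
  rw [isMinOn_iff, h]
  exact hmin

/-- The derivatives of `√u` along coordinate lines through a point of `Ω`, in terms of the
gradient `P` of `√u` and the second derivatives `H` of `√u`, which satisfy
`√u Δ√u = -(1 + |∇√u|²)`. -/
theorem exists_sqrt_derivs (hu : IsTorsionFunction Ω u) (hΩo : IsOpen Ω) {q : Euc n}
    (hq : q ∈ Ω) (hpos : 0 < u q) :
    ∃ P H : Fin n → ℝ, (∀ i c, HasTwoDerivsAtZero
        (fun s => √(u (q + s • c • EuclideanSpace.single i (1 : ℝ)))) (c * P i) (c ^ 2 * H i)) ∧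
      √(u q) * ∑ i, H i = -(1 + ∑ i, P i ^ 2) := by
  have hs : 0 < √(u q) := Real.sqrt_pos.2 hpos
  refine ⟨fun i => fderiv ℝ u q (EuclideanSpace.single i (1 : ℝ)) / (2 * √(u q)),
    fun i => iteratedFDeriv ℝ 2 u q (fun _ => EuclideanSpace.single i (1 : ℝ)) / (2 * √(u q))
      - (fderiv ℝ u q (EuclideanSpace.single i (1 : ℝ)) / (2 * √(u q))) ^ 2 / √(u q),
    fun i c => ?_, ?_⟩
  · have h := ((hu.contDiffAt hΩo hq).hasTwoDerivsAtZero_line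
      (EuclideanSpace.single i (1 : ℝ)) c).sqrt (by simpa using hpos)
    simp only [zero_smul, add_zero] at h
    convert h using 1 <;> ring
  · have hl := hu.lapl_eq q hq
    rw [lapl] at hl
    rw [Finset.sum_sub_distrib, ← Finset.sum_div, ← Finset.sum_div, hl]
    field_simp
    ring

/-- At a positive maximum of the concavity defect of `√u`, moving both end points with speeds
`√(u x)` and `√(u y)` contradicts the equation satisfied by `√u`. End points on the boundary
do not move. -/
theorem defect_nonpos (hu : IsTorsionFunction Ω u) (hΩo : IsOpen Ω) (hΩb : IsBounded Ω)
    (hΩc : Convex ℝ Ω) {a b : ℝ} (ha : 0 < a) (hb : 0 < b) (hab : a + b = 1)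
    {x y : Euc n} (hx : x ∈ closure Ω) (hy : y ∈ closure Ω)
    (hmax : IsMaxOn (fun p : Euc n × Euc n => a * √(u p.1) + b * √(u p.2) - √(u (a • p.1 + b • p.2)))
      (closure Ω ×ˢ closure Ω) (x, y)) :
    a * √(u x) + b * √(u y) - √(u (a • x + b • y)) ≤ 0 := by
  set z := a • x + b • y with hz
  by_cases hxy : x ∉ Ω ∧ y ∉ Ω
  · rw [hu.eq_zero_of_notMem hΩo hx hxy.1, hu.eq_zero_of_notMem hΩo hy hxy.2]
    simp
  have hzΩ : z ∈ Ω := by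
    rw [not_and_or, not_not, not_not] at hxy
    rw [← hΩo.interior_eq]
    rcases hxy with h | h
    · exact hΩc.combo_interior_closure_mem_interior (by rwa [hΩo.interior_eq]) hy ha hb.le hab
    · exact hΩc.combo_closure_interior_mem_interior hx (by rwa [hΩo.interior_eq]) ha.le hb hab
  have hzpos := hu.pos hΩo hΩb hzΩ
  obtain ⟨P, H, hPH, hsum⟩ := hu.exists_sqrt_derivs hΩo hzΩ hzpos
  have hconv := hΩc.closure
  have mem_closure_line : ∀ {q : Euc n} (_ : q ∈ closure Ω) (e : Euc n) (c : ℝ),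
      (q ∉ Ω → c = 0) → ∀ᶠ s : ℝ in 𝓝 0, q + s • c • e ∈ closure Ω := by
    intro q hq e c hc
    by_cases hqΩ : q ∈ Ω
    · exact (hΩo.eventually_line_mem hqΩ (c • e)).mono fun s hs => subset_closure hs
    · simp [hc hqΩ, hq]
  have local_max : ∀ (e : Euc n) (c d : ℝ), (x ∉ Ω → c = 0) → (y ∉ Ω → d = 0) →
      IsLocalMax (fun s : ℝ => a * √(u (x + s • c • e)) + b * √(u (y + s • d • e))
        - √(u (z + s • (a * c + b * d) • e))) 0 := by
    intro e c d hc hd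
    filter_upwards [mem_closure_line hx e c hc, mem_closure_line hy e d hd] with s h1 h2
    have h := isMaxOn_iff.1 hmax (x + s • c • e, y + s • d • e) ⟨h1, h2⟩
    have hlin : a • (x + s • c • e) + b • (y + s • d • e) = z + s • (a * c + b * d) • e := by
      rw [hz]
      module
    simp only [hlin] at h
    simpa using h
  have derivs : ∀ (q : Euc n) (r k : ℝ), q ∈ closure Ω → 0 < r →
      (q ∈ Ω → ∀ e : Euc n, IsLocalMax (fun s : ℝ => r * √(u (q + s • (1 : ℝ) • e)) + k
        - √(u (z + s • r • e))) 0) →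
      ∃ G : Fin n → ℝ, (∀ i, HasTwoDerivsAtZero
          (fun s => √(u (q + s • √(u q) • EuclideanSpace.single i (1 : ℝ))))
          (√(u q) * P i) (√(u q) ^ 2 * G i)) ∧
        √(u q) ^ 2 * ∑ i, G i = -√(u q) * (1 + ∑ i, P i ^ 2) := by
    intro q r k hq hr hloc
    by_cases hqΩ : q ∈ Ω
    · obtain ⟨Q, G, hQG, hG⟩ := hu.exists_sqrt_derivs hΩo hqΩ (hu.pos hΩo hΩb hqΩ)
      have hQP : Q = P := by
        funext i
        have h := (((hQG i 1).const_mul r).add (.const k)).sub (hPH i r)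
        have := (h.eq_zero_and_nonpos_of_isLocalMax (hloc hqΩ _)).1
        have h' : r * (Q i - P i) = 0 := by linarith
        rcases mul_eq_zero.1 h' with h' | h' <;> linarith
      subst hQP
      exact ⟨G, fun i => hQG i _, by linear_combination √(u q) * hG⟩
    · refine ⟨0, fun i => ?_, ?_⟩ <;> rw [hu.eq_zero_of_notMem hΩo hq hqΩ]
      · simpa using HasTwoDerivsAtZero.const (√(u q))
      · simp
  have sqrt_zero : ∀ q ∈ closure Ω, q ∉ Ω → √(u q) = 0 := fun q hq hqΩ => by
    rw [hu.eq_zero_of_notMem hΩo hq hqΩ, Real.sqrt_zero]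
  obtain ⟨Gx, hGx, hGx'⟩ := derivs x a (b * √(u y)) hx ha fun hxΩ e => by
    simpa using local_max e 1 0 (fun h => absurd hxΩ h) (fun _ => rfl)
  obtain ⟨Gy, hGy, hGy'⟩ := derivs y b (a * √(u x)) hy hb fun hyΩ e => by
    simpa [add_comm] using local_max e 0 1 (fun _ => rfl) (fun h => absurd hyΩ h)
  set m := a * √(u x) + b * √(u y) with hm
  have second : ∀ i, a * (√(u x) ^ 2 * Gx i) + b * (√(u y) ^ 2 * Gy i) - m ^ 2 * H i ≤ 0 :=
    fun i => (((((hGx i).const_mul a).add ((hGy i).const_mul b)).sub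
      (hPH i m)).eq_zero_and_nonpos_of_isLocalMax
        (local_max _ _ _ (sqrt_zero x hx) (sqrt_zero y hy))).2
  have total : a * (√(u x) ^ 2 * ∑ i, Gx i) + b * (√(u y) ^ 2 * ∑ i, Gy i)
      - m ^ 2 * ∑ i, H i ≤ 0 := by
    simp only [Finset.mul_sum, ← Finset.sum_add_distrib, ← Finset.sum_sub_distrib]
    exact Finset.sum_nonpos fun i _ => second i
  rw [hGx', hGy'] at total
  have hS : 0 < 1 + ∑ i, P i ^ 2 := by
    have : 0 ≤ ∑ i, P i ^ 2 := Finset.sum_nonneg fun i _ => sq_nonneg _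
    linarith
  have hv : 0 < √(u z) := Real.sqrt_pos.2 hzpos
  by_contra! hlt
  have hmz : √(u z) < m := by linarith
  have key : √(u z) * (-m * (1 + ∑ i, P i ^ 2) - m ^ 2 * ∑ i, H i) ≤ 0 :=
    mul_nonpos_of_nonneg_of_nonpos hv.le (by linear_combination total)
  have heq : √(u z) * (-m * (1 + ∑ i, P i ^ 2) - m ^ 2 * ∑ i, H i)
      = m * (m - √(u z)) * (1 + ∑ i, P i ^ 2) := by linear_combination -m ^ 2 * hsum
  have : 0 < m * (m - √(u z)) * (1 + ∑ i, P i ^ 2) :=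
    mul_pos (mul_pos (hv.trans hmz) (sub_pos.2 hmz)) hS
  linarith

end IsTorsionFunction

/-- The square root of the torsion function of an open bounded convex set is concave. -/
theorem sqrt_torsion_concaveOn (Ω : Set (Euc n))
    (hΩo : IsOpen Ω) (hΩb : IsBounded Ω) (hΩc : Convex ℝ Ω)
    (u : Euc n → ℝ) (hu : IsTorsionFunction Ω u) :
    ConcaveOn ℝ Ω (fun x => Real.sqrt (u x)) := by
  refine ⟨hΩc, fun x hx y hy a b ha hb hab => ?_⟩
  rcases ha.eq_or_lt with rfl | ha
  · simp [show b = 1 by linarith]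
  rcases hb.eq_or_lt with rfl | hb
  · simp [show a = 1 by linarith]
  have hsqrt : ContinuousOn (fun q => √(u q)) (closure Ω) := hu.continuousOn.sqrt
  have hcont : ContinuousOn
      (fun p : Euc n × Euc n => a * √(u p.1) + b * √(u p.2) - √(u (a • p.1 + b • p.2)))
      (closure Ω ×ˢ closure Ω) := by
    refine ((continuousOn_const.mul (hsqrt.comp continuousOn_fst fun p hp => hp.1)).add
      (continuousOn_const.mul (hsqrt.comp continuousOn_snd fun p hp => hp.2))).sub
      (hsqrt.comp (f := fun p : Euc n × Euc n => a • p.1 + b • p.2) (by fun_prop)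
        fun p hp => hΩc.closure hp.1 hp.2 ha.le hb.le hab)
  obtain ⟨⟨p, q⟩, hpq, hmax⟩ :=
    (hΩb.isCompact_closure.prod hΩb.isCompact_closure).exists_isMaxOn
      ⟨(x, y), subset_closure hx, subset_closure hy⟩ hcont
  have h1 := isMaxOn_iff.1 hmax (x, y) ⟨subset_closure hx, subset_closure hy⟩
  have h2 := hu.defect_nonpos hΩo hΩb hΩc ha hb hab hpq.1 hpq.2 hmax
  simp only [smul_eq_mul]
  linarith

end
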